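/- arXiv:2509.04038 — 2 statements merged into one kernel-verified Lean document; each statement's English description precedes it below -/
import Mathlib

section
/- Let x₁,…,x_N be real numbers with a ≤ x_j ≤ b for all j, let μ = (1/N)·Σ_{j=1}^N x_j, and let (X₁,…,X_n) with n ≤ N be a uniformly random sample of size n drawn from {x₁,…,x_N} without replacement. Then for every ε > 0, P( |Σ_{i=1}^n X_i − n·μ| ≥ n·ε ) ≤ 2·exp(−2·n·ε² / (b−a)²). -/
open MeasureTheory

section SamplingWithoutReplacement

variable {ι : Type*} [Fintype ι]

/-- Drawing a fresh element gives a smaller expected product than repeating an index. -/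
lemma sum_perm_prod_insert_le [DecidableEq ι] (y : ι → ℝ) (hy : ∀ i, 0 ≤ y i)
    {s : Finset ι} {m : ι}
    (hm : m ∉ s) (k : ι) :
    ∑ σ : Equiv.Perm ι, ∏ i ∈ insert m s, y (σ i) ≤
      ∑ σ : Equiv.Perm ι, (∏ i ∈ s, y (σ i)) * y (σ k) := by
  have prod_swap (u : Finset ι) (hmu : m ∉ u) (hku : k ∉ u) (σ : Equiv.Perm ι) :
      ∏ i ∈ u, y (σ (Equiv.swap m k i)) = ∏ i ∈ u, y (σ i) :=
    Finset.prod_congr rfl fun i hi => by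
      rw [Equiv.swap_apply_of_ne_of_ne (ne_of_mem_of_not_mem hi hmu)
        (ne_of_mem_of_not_mem hi hku)]
  have sum_swap (f : Equiv.Perm ι → ℝ) : ∑ σ, f σ = ∑ σ, f (σ * Equiv.swap m k) :=
    (Equiv.sum_comp (Equiv.mulRight (Equiv.swap m k)) f).symm
  simp_rw [Finset.prod_insert hm]
  by_cases hk : k ∈ s
  · have hme : m ∉ s.erase k := fun h => hm (Finset.mem_of_mem_erase h)
    have hke : k ∉ s.erase k := Finset.notMem_erase k s
    simp_rw [← Finset.mul_prod_erase s _ hk]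
    have h := sum_swap fun σ => y (σ k) * (∏ i ∈ s.erase k, y (σ i)) * y (σ k)
    simp only [prod_swap _ hme hke, Equiv.Perm.mul_apply, Equiv.swap_apply_right] at h
    have hsq : 0 ≤ ∑ σ : Equiv.Perm ι, (∏ i ∈ s.erase k, y (σ i)) * (y (σ k) - y (σ m)) ^ 2 :=
      Finset.sum_nonneg fun σ _ =>
        mul_nonneg (Finset.prod_nonneg fun i _ => hy _) (sq_nonneg _)
    have hexp : ∑ σ : Equiv.Perm ι, (∏ i ∈ s.erase k, y (σ i)) * (y (σ k) - y (σ m)) ^ 2 =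
        ∑ σ : Equiv.Perm ι, y (σ k) * (∏ i ∈ s.erase k, y (σ i)) * y (σ k)
        + ∑ σ : Equiv.Perm ι, y (σ m) * (∏ i ∈ s.erase k, y (σ i)) * y (σ m)
        - 2 * ∑ σ : Equiv.Perm ι, y (σ m) * (y (σ k) * ∏ i ∈ s.erase k, y (σ i)) := by
      rw [Finset.mul_sum, ← Finset.sum_add_distrib, ← Finset.sum_sub_distrib]
      exact Finset.sum_congr rfl fun σ _ => by ring
    linarith
  · rw [sum_swap]
    simp only [prod_swap _ hm hk, Equiv.Perm.mul_apply, Equiv.swap_apply_left]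
    exact (Finset.sum_congr rfl fun σ _ => mul_comm _ _).le

/-- The expected product of a sample without replacement is at most that of an independent
sample (Maclaurin's inequality). -/
lemma sum_perm_prod_mul_card_pow_le [DecidableEq ι] (y : ι → ℝ) (hy : ∀ i, 0 ≤ y i)
    (s : Finset ι) :
    (∑ σ : Equiv.Perm ι, ∏ i ∈ s, y (σ i)) * (Fintype.card ι : ℝ) ^ s.card ≤
      (Fintype.card (Equiv.Perm ι) : ℝ) * (∑ i, y i) ^ s.card := by
  induction s using Finset.induction_on with
  | empty => simp
  | insert m s hm ih =>
    have step : (∑ σ : Equiv.Perm ι, ∏ i ∈ insert m s, y (σ i)) * (Fintype.card ι : ℝ) ≤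
        (∑ σ : Equiv.Perm ι, ∏ i ∈ s, y (σ i)) * ∑ i, y i :=
      calc (∑ σ : Equiv.Perm ι, ∏ i ∈ insert m s, y (σ i)) * (Fintype.card ι : ℝ)
          = ∑ _k : ι, ∑ σ : Equiv.Perm ι, ∏ i ∈ insert m s, y (σ i) := by
            simp [mul_comm]
        _ ≤ ∑ k : ι, ∑ σ : Equiv.Perm ι, (∏ i ∈ s, y (σ i)) * y (σ k) :=
            Finset.sum_le_sum fun k _ => sum_perm_prod_insert_le y hy hm k
        _ = (∑ σ : Equiv.Perm ι, ∏ i ∈ s, y (σ i)) * ∑ i, y i := by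
            rw [Finset.sum_comm, Finset.sum_mul]
            exact Finset.sum_congr rfl fun σ _ => by
              rw [← Finset.mul_sum, Equiv.sum_comp σ y]
    rw [Finset.card_insert_of_notMem hm, pow_succ', pow_succ]
    calc _ = ((∑ σ : Equiv.Perm ι, ∏ i ∈ insert m s, y (σ i)) * (Fintype.card ι : ℝ))
            * (Fintype.card ι : ℝ) ^ s.card := by ring
      _ ≤ ((∑ σ : Equiv.Perm ι, ∏ i ∈ s, y (σ i)) * ∑ i, y i)
            * (Fintype.card ι : ℝ) ^ s.card := by gcongr
      _ = ((∑ σ : Equiv.Perm ι, ∏ i ∈ s, y (σ i)) * (Fintype.card ι : ℝ) ^ s.card)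
            * ∑ i, y i := by ring
      _ ≤ ((Fintype.card (Equiv.Perm ι) : ℝ) * (∑ i, y i) ^ s.card) * ∑ i, y i :=
          mul_le_mul_of_nonneg_right ih (Finset.sum_nonneg fun i _ => hy i)
      _ = _ := by ring

lemma integral_uniformOfFintype {α : Type*} [Fintype α] [Nonempty α] [MeasurableSpace α]
    [MeasurableSingletonClass α] (f : α → ℝ) :
    ∫ a, f a ∂(PMF.uniformOfFintype α).toMeasure = (∑ a, f a) / Fintype.card α := by
  simp [PMF.integral_eq_sum, ← Finset.mul_sum, div_eq_inv_mul]

/-- Hoeffding's lemma for the uniform distribution on a finite type. -/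
lemma sum_exp_div_card_le [Nonempty ι] (x : ι → ℝ) (a b : ℝ) (hx : ∀ j, x j ∈ Set.Icc a b)
    (t : ℝ) :
    (∑ j, Real.exp (t * (x j - (∑ i, x i) / Fintype.card ι))) / Fintype.card ι ≤
      Real.exp (((‖b - a‖₊ / 2) ^ 2 : NNReal) * t ^ 2 / 2) := by
  let _ : MeasurableSpace ι := ⊤
  have h := (ProbabilityTheory.hasSubgaussianMGF_of_mem_Icc
    (μ := (PMF.uniformOfFintype ι).toMeasure) (X := x) (measurable_of_finite x).aemeasurable
    (Filter.Eventually.of_forall hx)).mgf_le t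
  simpa only [ProbabilityTheory.mgf, integral_uniformOfFintype] using h

/-- The centred sum of a sample without replacement is sub-Gaussian. -/
lemma hasSubgaussianMGF_sum_perm [DecidableEq ι] [Nonempty ι] [MeasurableSpace (Equiv.Perm ι)]
    [MeasurableSingletonClass (Equiv.Perm ι)] (x : ι → ℝ) (a b : ℝ)
    (hx : ∀ j, x j ∈ Set.Icc a b) (s : Finset ι) :
    ProbabilityTheory.HasSubgaussianMGF
      (fun σ : Equiv.Perm ι => ∑ i ∈ s, (x (σ i) - (∑ j, x j) / Fintype.card ι))
      (s.card * (‖b - a‖₊ / 2) ^ 2) (PMF.uniformOfFintype (Equiv.Perm ι)).toMeasure where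
  integrable_exp_mul t := .of_finite
  mgf_le t := by
    have hprod := sum_perm_prod_mul_card_pow_le
      (fun j => Real.exp (t * (x j - (∑ i, x i) / Fintype.card ι))) (fun _ => (Real.exp_pos _).le) s
    have hcard : (0 : ℝ) < Fintype.card ι := by exact_mod_cast Fintype.card_pos
    have hperm : (0 : ℝ) < Fintype.card (Equiv.Perm ι) := by exact_mod_cast Fintype.card_pos
    simp only [ProbabilityTheory.mgf, integral_uniformOfFintype, Finset.mul_sum, Real.exp_sum]
    calc _ ≤ ((∑ j, Real.exp (t * (x j - (∑ i, x i) / Fintype.card ι))) / Fintype.card ι)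
            ^ s.card := by
          rw [div_pow, div_le_div_iff₀ hperm (pow_pos hcard _), mul_comm (_ ^ _)]
          exact hprod
      _ ≤ Real.exp (((‖b - a‖₊ / 2) ^ 2 : NNReal) * t ^ 2 / 2) ^ s.card := by
          gcongr
          exact sum_exp_div_card_le x a b hx t
      _ = _ := by
          rw [← Real.exp_nat_mul]
          push_cast
          ring_nf

end SamplingWithoutReplacement

/-- **Hoeffding's inequality for sampling without replacement.**
Let `x₁,…,x_N` be reals with `a ≤ xⱼ ≤ b`, let `μ = (1/N)·∑ⱼ xⱼ`, and let
`(X₁,…,Xₙ)` with `n ≤ N` be a uniformly random sample of size `n` drawn without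
replacement, i.e. the first `n` coordinates of a uniformly random ordering
(a uniform random permutation `σ` of the indices, `Xᵢ = x_{σ(i)}`).  Then for
every `ε > 0`, `P(|∑_{i=1}^n Xᵢ − n·μ| ≥ n·ε) ≤ 2·exp(−2·n·ε²/(b−a)²)`. -/
theorem stmt1 (N : ℕ) (x : Fin N → ℝ) (a b : ℝ)
    (hx : ∀ j, a ≤ x j ∧ x j ≤ b)
    (n : ℕ) (hn : n ≤ N) (ε : ℝ) (hε : 0 < ε) :
    letI : MeasurableSpace (Equiv.Perm (Fin N)) := ⊤
    (PMF.uniformOfFintype (Equiv.Perm (Fin N))).toMeasure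
        {σ : Equiv.Perm (Fin N) |
          (n : ℝ) * ε ≤ |(∑ i : Fin n, x (σ (Fin.castLE hn i)))
                - n * ((∑ j : Fin N, x j) / N)|}
      ≤ ENNReal.ofReal (2 * Real.exp (-(2 * n * ε ^ 2) / (b - a) ^ 2)) := by
  let _ : MeasurableSpace (Equiv.Perm (Fin N)) := ⊤
  set P := (PMF.uniformOfFintype (Equiv.Perm (Fin N))).toMeasure with hP
  rcases Nat.eq_zero_or_pos n with rfl | hnpos
  · refine prob_le_one.trans ?_
    simp
  have : Nonempty (Fin N) := ⟨⟨0, hnpos.trans_le hn⟩⟩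
  have hn' : (0 : ℝ) < n := by exact_mod_cast hnpos
  have hsub := hasSubgaussianMGF_sum_perm x a b hx
    (Finset.univ.map (Fin.castLEEmb hn))
  simp only [Finset.sum_map, Fin.coe_castLEEmb, Finset.card_map, Finset.card_univ,
    Fintype.card_fin, Finset.sum_sub_distrib, Finset.sum_const, nsmul_eq_mul, ← hP] at hsub
  have hexp : -(n * ε) ^ 2 / (2 * (((n : NNReal) * (‖b - a‖₊ / 2) ^ 2 : NNReal) : ℝ)) =
      -(2 * n * ε ^ 2) / (b - a) ^ 2 := by
    push_cast
    rw [div_pow, Real.norm_eq_abs, sq_abs]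
    rcases eq_or_ne (b - a) 0 with h | h
    · simp [h]
    · field_simp
  have hε' : 0 ≤ n * ε := by positivity
  have hup := hsub.measure_ge_le hε'
  have hlow := hsub.neg.measure_ge_le hε'
  rw [hexp] at hup hlow
  rw [ENNReal.le_ofReal_iff_toReal_le (measure_ne_top _ _) (by positivity), ← measureReal_def]
  refine (measureReal_mono ?_ (measure_ne_top _ _)).trans
    ((measureReal_union_le _ _).trans ((add_le_add hup hlow).trans_eq (two_mul _).symm))
  intro σ hσ
  rw [Set.mem_ofPred_eq, le_abs] at hσ
  exact hσ
end

section
/- Under the small individual contribution assumption, every campaign's cumulative spend exceeds its budget by at most C/N: for every n ∈ [0, N] and every c ∈ 𝓒, s_n^c < b^c + C/N. -/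
/-- The sequential spend process of the budget-capped auction system: `s₀^c = 0`
and `s_n = s_{n−1} + f(e_n, a_{n−1})`, where the activation vector is
`a_n^c = 1` iff `s_n^c < b^c`, and `ev k` is the event `e_{k+1}`. -/
noncomputable def seqSpend {E C : Type*} (f : E → (C → Bool) → C → ℝ)
    (b : C → ℝ) (ev : ℕ → E) : ℕ → C → ℝ
  | 0 => fun _ => 0
  | n + 1 => fun c =>
      seqSpend f b ev n c +
        f (ev n)
          (fun c' => @decide (seqSpend f b ev n c' < b c') (Classical.propDecidable _)) c

/-- **overshoot is at most `C/N`.**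
Under the small individual contribution assumption (`f^c(e,a) < C/N` with
`C > 0`), together with `f^c(e,a) = 0` whenever `a^c = 0`, the cumulative spend
of every campaign exceeds its budget by at most `C/N`: for every `n ∈ [0,N]`
and every campaign `c`, `s_n^c < b^c + C/N`. -/
theorem stmt8 {E C_ : Type*} [Fintype E] [Fintype C_]
    (N : ℕ) (hN : 0 < N) (hcardE : Fintype.card E = N)
    (f : E → (C_ → Bool) → C_ → ℝ) (b : C_ → ℝ) (hb : ∀ c, 0 < b c)
    (hfpos : ∀ e a c, 0 ≤ f e a c)
    (hf0 : ∀ e (a : C_ → Bool) c, a c = false → f e a c = 0)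
    (C : ℝ) (hC : 0 < C)
    (hsmall : ∀ e a c, f e a c < C / N)
    (ev : ℕ → E) (n : ℕ) (hn : n ≤ N) (c : C_) :
    seqSpend f b ev n c < b c + C / N := by
  clear hn
  induction n with
  | zero =>
    have hCN : 0 < C / (N : ℝ) := by positivity
    simpa only [seqSpend] using add_pos (hb c) hCN
  | succ k ih =>
    simp only [seqSpend]
    by_cases h : seqSpend f b ev k c < b c
    · exact add_lt_add h (hsmall _ _ _)
    · rw [hf0 _ _ c (decide_eq_false h), add_zero]
      exact ih
end
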